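/- Let A : ℝ → ℝ be continuous with a₀ ≤ A(q) ≤ A₀ for all q ∈ ℝ, where 0 < a₀ ≤ A₀. For t > 0 define F₁(t)φ(q) = ∫_ℝ (4πt A(q))^{-1/2} exp( −(q − q₁)²/(4t A(q)) ) φ(q₁) dq₁. Then for every φ ∈ C_c^∞(ℝ) and every t > 0, ‖ (F₁(t)φ − φ)/t − A·φ'' ‖_{L¹(ℝ)} ≤ t · A₀^{5/2} a₀^{-1/2} · ‖φ''''‖_{L¹(ℝ)}, where A·φ'' denotes the function q ↦ A(q)φ''(q) and φ'''' is the fourth derivative of φ. -/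

import Mathlib

open MeasureTheory Filter Topology Set

noncomputable section

section GaussianMoments

variable {b : ℝ}

lemma integrable_pow_mul_exp_neg_mul_sq (hb : 0 < b) (k : ℕ) :
    Integrable fun y : ℝ ↦ y ^ k * Real.exp (-b * y ^ 2) := by
  simpa [Real.rpow_natCast] using
    integrable_rpow_mul_exp_neg_mul_sq hb (s := k) (by linarith [k.cast_nonneg (α := ℝ)])

lemma hasDerivAt_exp_neg_mul_sq (b y : ℝ) :
    HasDerivAt (fun y : ℝ ↦ Real.exp (-b * y ^ 2)) (-(2 * b) * (y * Real.exp (-b * y ^ 2))) y := by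
  convert ((hasDerivAt_pow 2 y).const_mul (-b)).exp using 1
  push_cast
  ring

lemma integral_mul_exp_neg_mul_sq (hb : 0 < b) :
    ∫ y : ℝ, y * Real.exp (-b * y ^ 2) = 0 := by
  have h := integral_eq_zero_of_hasDerivAt_of_integrable (hasDerivAt_exp_neg_mul_sq b)
    ((integrable_mul_exp_neg_mul_sq hb).const_mul _) (integrable_exp_neg_mul_sq hb)
  rw [integral_const_mul] at h
  exact (mul_eq_zero.mp h).resolve_left (by linarith)

lemma integral_pow_add_two_mul_exp_neg_mul_sq (hb : 0 < b) (k : ℕ) :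
    ∫ y : ℝ, y ^ (k + 2) * Real.exp (-b * y ^ 2) =
      (k + 1) / (2 * b) * ∫ y : ℝ, y ^ k * Real.exp (-b * y ^ 2) := by
  have hd (y : ℝ) : HasDerivAt (fun y : ℝ ↦ y ^ (k + 1) * Real.exp (-b * y ^ 2))
      ((k + 1) * (y ^ k * Real.exp (-b * y ^ 2))
        - 2 * b * (y ^ (k + 2) * Real.exp (-b * y ^ 2))) y := by
    refine ((hasDerivAt_pow (k + 1) y).mul (hasDerivAt_exp_neg_mul_sq b y)).congr_deriv ?_
    push_cast
    ring
  have h₁ := (integrable_pow_mul_exp_neg_mul_sq hb k).const_mul ((k : ℝ) + 1)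
  have h₂ := (integrable_pow_mul_exp_neg_mul_sq hb (k + 2)).const_mul (2 * b)
  have h := integral_eq_zero_of_hasDerivAt_of_integrable hd (h₁.sub h₂)
    (integrable_pow_mul_exp_neg_mul_sq hb (k + 1))
  rw [integral_sub h₁ h₂, integral_const_mul, integral_const_mul] at h
  rw [div_mul_eq_mul_div, eq_div_iff (by positivity)]
  linarith

end GaussianMoments

/-- The heat kernel on `ℝ` at time `s`: the centred Gaussian density with variance `2s`. -/
def heatKernel (s y : ℝ) : ℝ := (4 * Real.pi * s) ^ (-(1 : ℝ) / 2) * Real.exp (-y ^ 2 / (4 * s))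

section HeatKernel

variable {s : ℝ}

lemma heatKernel_nonneg (hs : 0 < s) (y : ℝ) : 0 ≤ heatKernel s y := by
  unfold heatKernel; positivity

lemma heatKernel_eq (s y : ℝ) :
    heatKernel s y = (4 * Real.pi * s) ^ (-(1 : ℝ) / 2) * Real.exp (-(4 * s)⁻¹ * y ^ 2) := by
  rw [heatKernel]; congr 2; ring

lemma pow_mul_heatKernel_eq (s : ℝ) (k : ℕ) : (fun y ↦ y ^ k * heatKernel s y) =
    fun y ↦ (4 * Real.pi * s) ^ (-(1 : ℝ) / 2) * (y ^ k * Real.exp (-(4 * s)⁻¹ * y ^ 2)) := by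
  ext y; rw [heatKernel_eq]; ring

lemma integrable_pow_mul_heatKernel (hs : 0 < s) (k : ℕ) :
    Integrable fun y ↦ y ^ k * heatKernel s y := by
  rw [pow_mul_heatKernel_eq]
  exact (integrable_pow_mul_exp_neg_mul_sq (by positivity) k).const_mul _

lemma integral_heatKernel (hs : 0 < s) : ∫ y, heatKernel s y = 1 := by
  simp_rw [heatKernel_eq]
  rw [integral_const_mul, integral_gaussian, Real.sqrt_eq_rpow, div_inv_eq_mul,
    show Real.pi * (4 * s) = 4 * Real.pi * s by ring, ← Real.rpow_add (by positivity)]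
  norm_num

lemma integral_mul_heatKernel (hs : 0 < s) : ∫ y, y * heatKernel s y = 0 := by
  have h := pow_mul_heatKernel_eq s 1
  simp only [pow_one] at h
  rw [h, integral_const_mul, integral_mul_exp_neg_mul_sq (by positivity), mul_zero]

lemma integral_pow_add_two_mul_heatKernel (hs : 0 < s) (k : ℕ) :
    ∫ y, y ^ (k + 2) * heatKernel s y = 2 * s * (k + 1) * ∫ y, y ^ k * heatKernel s y := by
  rw [pow_mul_heatKernel_eq, pow_mul_heatKernel_eq, integral_const_mul, integral_const_mul,
    integral_pow_add_two_mul_exp_neg_mul_sq (by positivity)]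
  field_simp
  ring

lemma integral_sq_mul_heatKernel (hs : 0 < s) : ∫ y, y ^ 2 * heatKernel s y = 2 * s := by
  simpa [integral_heatKernel hs] using integral_pow_add_two_mul_heatKernel hs 0

lemma integral_pow_three_mul_heatKernel (hs : 0 < s) : ∫ y, y ^ 3 * heatKernel s y = 0 := by
  simpa [integral_mul_heatKernel hs] using integral_pow_add_two_mul_heatKernel hs 1

lemma integral_pow_four_mul_heatKernel (hs : 0 < s) :
    ∫ y, y ^ 4 * heatKernel s y = 12 * s ^ 2 := by
  have h := integral_pow_add_two_mul_heatKernel hs 2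
  rw [integral_sq_mul_heatKernel hs] at h
  rw [h]
  push_cast
  ring

lemma heatKernel_le {a r R : ℝ} (ha : 0 < a) (har : a ≤ r) (hrR : r ≤ R) (y : ℝ) :
    heatKernel r y ≤ R ^ ((1 : ℝ) / 2) * a ^ (-(1 : ℝ) / 2) * heatKernel R y := by
  have hr : 0 < r := ha.trans_le har
  have hR : 0 < R := hr.trans_le hrR
  have h4 : (0 : ℝ) ≤ 4 * Real.pi := by positivity
  have hRR : R ^ ((1 : ℝ) / 2) * R ^ (-(1 : ℝ) / 2) = 1 := by
    rw [← Real.rpow_add hR]; norm_num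
  have hrpow : r ^ (-(1 : ℝ) / 2) ≤ a ^ (-(1 : ℝ) / 2) :=
    Real.rpow_le_rpow_of_nonpos ha har (by norm_num)
  have hexp : Real.exp (-y ^ 2 / (4 * r)) ≤ Real.exp (-y ^ 2 / (4 * R)) := by
    rw [Real.exp_le_exp, neg_div, neg_div, neg_le_neg_iff]
    gcongr
  unfold heatKernel
  rw [Real.mul_rpow h4 hr.le, Real.mul_rpow h4 hR.le]
  calc (4 * Real.pi) ^ (-(1 : ℝ) / 2) * r ^ (-(1 : ℝ) / 2) * Real.exp (-y ^ 2 / (4 * r))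
      ≤ (4 * Real.pi) ^ (-(1 : ℝ) / 2) * a ^ (-(1 : ℝ) / 2) * Real.exp (-y ^ 2 / (4 * R)) := by
        gcongr
    _ = (4 * Real.pi) ^ (-(1 : ℝ) / 2) * a ^ (-(1 : ℝ) / 2) * Real.exp (-y ^ 2 / (4 * R)) *
          (R ^ ((1 : ℝ) / 2) * R ^ (-(1 : ℝ) / 2)) := by rw [hRR, mul_one]
    _ = _ := by ring

end HeatKernel

section Taylor

variable {E : Type*} [NormedAddCommGroup E] [NormedSpace ℝ E] {φ : ℝ → E}

lemma ContDiff.hasDerivAt_iteratedDeriv {n : ℕ} (hφ : ContDiff ℝ n φ) {k : ℕ} (hk : k < n)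
    (x : ℝ) : HasDerivAt (iteratedDeriv k φ) (iteratedDeriv (k + 1) φ x) x := by
  rw [iteratedDeriv_succ]
  exact (hφ.differentiable_iteratedDeriv k (by exact_mod_cast hk) x).hasDerivAt

protected lemma HasCompactSupport.iteratedDeriv (hφ : HasCompactSupport φ) (k : ℕ) :
    HasCompactSupport (iteratedDeriv k φ) := by
  induction k with
  | zero => simpa using hφ
  | succ k ih => simpa [iteratedDeriv_succ] using ih.deriv

/-- The third order Taylor remainder of `φ` at `q`, as a function of the increment. -/
def cubicRemainder (φ : ℝ → E) (q y : ℝ) : E :=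
  φ (q + y) - φ q - y • iteratedDeriv 1 φ q - (y ^ 2 / 2) • iteratedDeriv 2 φ q
    - (y ^ 3 / 6) • iteratedDeriv 3 φ q

lemma cubicRemainder_eq [CompleteSpace E] (hφ : ContDiff ℝ 4 φ) (q y : ℝ) :
    cubicRemainder φ q y =
      ∫ u in (0 : ℝ)..1, (y ^ 4 * ((1 - u) ^ 3 / 6)) • iteratedDeriv 4 φ (q + u * y) := by
  have hφ' : ContDiff ℝ (4 : ℕ) φ := hφ
  have hd (k : ℕ) (hk : k < 4) (u : ℝ) : HasDerivAt (fun u : ℝ ↦ iteratedDeriv k φ (q + u * y))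
      (y • iteratedDeriv (k + 1) φ (q + u * y)) u :=
    (hφ'.hasDerivAt_iteratedDeriv hk _).scomp u
      ((((hasDerivAt_id u).mul_const y).const_add q).congr_deriv (one_mul y))
  have hsub (u : ℝ) : HasDerivAt (fun u : ℝ ↦ 1 - u) (-1) u := by
    simpa using (hasDerivAt_id u).const_sub 1
  have hF (u : ℝ) : HasDerivAt (fun u : ℝ ↦ iteratedDeriv 0 φ (q + u * y)
      + ((1 - u) * y) • iteratedDeriv 1 φ (q + u * y)
      + ((1 - u) ^ 2 * (y ^ 2 / 2)) • iteratedDeriv 2 φ (q + u * y)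
      + ((1 - u) ^ 3 * (y ^ 3 / 6)) • iteratedDeriv 3 φ (q + u * y))
      ((y ^ 4 * ((1 - u) ^ 3 / 6)) • iteratedDeriv 4 φ (q + u * y)) u := by
    refine ((((hd 0 (by norm_num) u).add
      (((hsub u).mul_const y).smul (hd 1 (by norm_num) u))).add
      ((((hsub u).pow 2).mul_const (y ^ 2 / 2)).smul (hd 2 (by norm_num) u))).add
      ((((hsub u).pow 3).mul_const (y ^ 3 / 6)).smul (hd 3 (by norm_num) u))).congr_deriv ?_
    simp only [Pi.pow_apply]
    push_cast
    module
  have hc : Continuous fun u : ℝ ↦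
      (y ^ 4 * ((1 - u) ^ 3 / 6)) • iteratedDeriv 4 φ (q + u * y) := by
    have := hφ'.continuous_iteratedDeriv 4 le_rfl
    fun_prop
  rw [intervalIntegral.integral_eq_sub_of_hasDerivAt (fun u _ ↦ hF u)
    (hc.intervalIntegrable _ _)]
  simp only [cubicRemainder, iteratedDeriv_zero]
  norm_num
  module

lemma norm_cubicRemainder_le [CompleteSpace E] (hφ : ContDiff ℝ 4 φ) (q y : ℝ) :
    ‖cubicRemainder φ q y‖ ≤
      ∫ u in Ioc (0 : ℝ) 1, y ^ 4 * ((1 - u) ^ 3 / 6) * ‖iteratedDeriv 4 φ (q + u * y)‖ := by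
  rw [cubicRemainder_eq hφ, intervalIntegral.integral_of_le zero_le_one]
  refine (norm_integral_le_integral_norm _).trans_eq
    (setIntegral_congr_fun measurableSet_Ioc fun u hu ↦ ?_)
  have : 0 ≤ 1 - u := by linarith [hu.2]
  simp only [norm_smul]
  rw [Real.norm_of_nonneg (by positivity)]

lemma integral_heatKernel_smul_cubicRemainder [CompleteSpace E] (hφ : Continuous φ)
    (hsupp : HasCompactSupport φ) {s : ℝ} (hs : 0 < s) (q : ℝ) :
    ∫ y, heatKernel s y • cubicRemainder φ q y =
      (∫ y, heatKernel s y • φ (q + y)) - φ q - s • iteratedDeriv 2 φ q := by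
  have hK : Continuous (heatKernel s) := by unfold heatKernel; fun_prop
  have hi : Integrable fun y ↦ heatKernel s y • φ (q + y) :=
    (hK.smul (hφ.comp (continuous_const.add continuous_id))).integrable_of_hasCompactSupport
      ((hsupp.comp_homeomorph (Homeomorph.addLeft q)).smul_left)
  have h₀ : Integrable (heatKernel s) := by simpa using integrable_pow_mul_heatKernel hs 0
  have h₁ : Integrable fun y ↦ y * heatKernel s y := by
    simpa using integrable_pow_mul_heatKernel hs 1
  have e : (fun y ↦ heatKernel s y • cubicRemainder φ q y) = fun y ↦
      heatKernel s y • φ (q + y) - heatKernel s y • φ q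
        - (y * heatKernel s y) • iteratedDeriv 1 φ q
        - (y ^ 2 * heatKernel s y) • ((1 / 2 : ℝ) • iteratedDeriv 2 φ q)
        - (y ^ 3 * heatKernel s y) • ((1 / 6 : ℝ) • iteratedDeriv 3 φ q) := by
    ext y
    simp only [cubicRemainder]
    module
  have i₀ := h₀.smul_const (φ q)
  have i₁ := h₁.smul_const (iteratedDeriv 1 φ q)
  have i₂ := (integrable_pow_mul_heatKernel hs 2).smul_const ((1 / 2 : ℝ) • iteratedDeriv 2 φ q)
  have i₃ := (integrable_pow_mul_heatKernel hs 3).smul_const ((1 / 6 : ℝ) • iteratedDeriv 3 φ q)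
  rw [e, integral_sub (((hi.sub' i₀).sub' i₁).sub' i₂) i₃,
    integral_sub ((hi.sub' i₀).sub' i₁) i₂, integral_sub (hi.sub' i₀) i₁, integral_sub hi i₀]
  simp only [integral_smul_const, integral_heatKernel hs, integral_mul_heatKernel hs,
    integral_sq_mul_heatKernel hs, integral_pow_three_mul_heatKernel hs]
  module

end Taylor

section Shift

variable {β : Type*} [MeasurableSpace β] {ν : Measure β} [SFinite ν] {w v : β → ℝ} {f : ℝ → ℝ}

lemma MeasureTheory.Integrable.mul_comp_add_prod (hw : Integrable w ν) (hv : Measurable v)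
    (hf : Integrable f) (hfc : Continuous f) :
    Integrable (fun z : ℝ × β ↦ w z.2 * f (z.1 + v z.2)) (volume.prod ν) := by
  have hm : AEStronglyMeasurable (fun z : ℝ × β ↦ w z.2 * f (z.1 + v z.2)) (volume.prod ν) :=
    hw.aestronglyMeasurable.comp_snd.mul (hfc.measurable.comp
      (measurable_fst.add (hv.comp measurable_snd))).aestronglyMeasurable
  refine (integrable_prod_iff' hm).mpr
    ⟨.of_forall fun p ↦ (hf.comp_add_right (v p)).const_mul (w p), ?_⟩
  have hshift (p : β) : ∫ x, ‖f (x + v p)‖ = ∫ x, ‖f x‖ :=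
    integral_add_right_eq_self (fun x ↦ ‖f x‖) (v p)
  simp_rw [norm_mul, integral_const_mul, hshift]
  exact hw.norm.mul_const _

lemma integral_integral_mul_comp_add (hw : Integrable w ν) (hv : Measurable v)
    (hf : Integrable f) (hfc : Continuous f) :
    ∫ q, ∫ p, w p * f (q + v p) ∂ν = (∫ p, w p ∂ν) * ∫ q, f q := by
  rw [integral_integral_swap (hw.mul_comp_add_prod hv hf hfc)]
  have hshift (p : β) : ∫ x, f (x + v p) = ∫ x, f x := integral_add_right_eq_self f (v p)
  simp_rw [integral_const_mul, hshift]
  exact integral_mul_const _ _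

end Shift

lemma integral_Ioc_one_sub_pow_three : ∫ u in Ioc (0 : ℝ) 1, (1 - u) ^ 3 / 6 = 1 / 24 := by
  rw [← intervalIntegral.integral_of_le zero_le_one, intervalIntegral.integral_div,
    intervalIntegral.integral_comp_sub_left (fun u ↦ u ^ 3) 1, integral_pow]
  norm_num

/-- The `L¹` estimate for the heat flow `φ ↦ ∫ heatKernel (s q) y • φ (q + y) dy` with variable
time `s`. -/
lemma integral_norm_heatKernel_sub_le {E : Type*} [NormedAddCommGroup E] [NormedSpace ℝ E]
    [CompleteSpace E] {φ : ℝ → E} (hφ : ContDiff ℝ 4 φ) (hsupp : HasCompactSupport φ)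
    {s : ℝ → ℝ} {a R : ℝ} (ha : 0 < a) (hs : ∀ q, a ≤ s q ∧ s q ≤ R) :
    ∫ q, ‖(∫ y, heatKernel (s q) y • φ (q + y)) - φ q - s q • iteratedDeriv 2 φ q‖ ≤
      R ^ ((1 : ℝ) / 2) * a ^ (-(1 : ℝ) / 2) * (R ^ 2 / 2) * ∫ q, ‖iteratedDeriv 4 φ q‖ := by
  have hR : 0 < R := ha.trans_le ((hs 0).1.trans (hs 0).2)
  set C : ℝ := R ^ ((1 : ℝ) / 2) * a ^ (-(1 : ℝ) / 2)
  have hψc : Continuous (iteratedDeriv 4 φ) := hφ.continuous_iteratedDeriv 4 le_rfl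
  have hψ : Integrable (iteratedDeriv 4 φ) :=
    hψc.integrable_of_hasCompactSupport (hsupp.iteratedDeriv 4)
  let μ : Measure ℝ := volume.restrict (Ioc 0 1)
  let w : ℝ × ℝ → ℝ := fun p ↦ (p.1 ^ 4 * heatKernel R p.1) * ((1 - p.2) ^ 3 / 6)
  have hw : Integrable w (volume.prod μ) :=
    (integrable_pow_mul_heatKernel hR 4).mul_prod
      (f := fun y ↦ y ^ 4 * heatKernel R y) (g := fun u : ℝ ↦ (1 - u) ^ 3 / 6)
      ((by fun_prop : Continuous fun u : ℝ ↦ (1 - u) ^ 3 / 6).integrableOn_Ioc)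
  have hw_int : ∫ p, w p ∂(volume.prod μ) = R ^ 2 / 2 := by
    rw [integral_prod_mul (fun y ↦ y ^ 4 * heatKernel R y) (fun u : ℝ ↦ (1 - u) ^ 3 / 6),
      integral_pow_four_mul_heatKernel hR, integral_Ioc_one_sub_pow_three]
    ring
  have hv : Measurable fun p : ℝ × ℝ ↦ p.2 * p.1 := by fun_prop
  have hk := hw.mul_comp_add_prod hv hψ.norm hψc.norm
  have hbound : ∀ᵐ q, ‖(∫ y, heatKernel (s q) y • φ (q + y)) - φ q - s q • iteratedDeriv 2 φ q‖ ≤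
      C * ∫ p, w p * ‖iteratedDeriv 4 φ (q + p.2 * p.1)‖ ∂(volume.prod μ) := by
    filter_upwards [hk.prod_right_ae] with q hq
    have hsq : 0 < s q := ha.trans_le (hs q).1
    rw [← integral_heatKernel_smul_cubicRemainder hφ.continuous hsupp hsq, integral_prod _ hq,
      ← integral_const_mul]
    refine norm_integral_le_of_norm_le (hq.integral_prod_left.const_mul C) (.of_forall fun y ↦ ?_)
    rw [norm_smul, Real.norm_of_nonneg (heatKernel_nonneg hsq y)]
    calc heatKernel (s q) y * ‖cubicRemainder φ q y‖
        ≤ C * heatKernel R y * ∫ u, y ^ 4 * ((1 - u) ^ 3 / 6) *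
            ‖iteratedDeriv 4 φ (q + u * y)‖ ∂μ :=
          mul_le_mul (heatKernel_le ha (hs q).1 (hs q).2 y) (norm_cubicRemainder_le hφ q y)
            (norm_nonneg _) (mul_nonneg (by positivity) (heatKernel_nonneg hR y))
      _ = C * ∫ u, w (y, u) * ‖iteratedDeriv 4 φ (q + u * y)‖ ∂μ := by
          rw [mul_assoc, ← integral_const_mul]
          congr 2 with u
          simp only [w]
          ring
  calc _ ≤ ∫ q, C * ∫ p, w p * ‖iteratedDeriv 4 φ (q + p.2 * p.1)‖ ∂(volume.prod μ) :=
        integral_mono_of_nonneg (.of_forall fun _ ↦ norm_nonneg _)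
          (hk.integral_prod_left.const_mul C) hbound
    _ = _ := by
        rw [integral_const_mul, integral_integral_mul_comp_add hw hv hψ.norm hψc.norm, hw_int]
        ring

/-- Quantitative convergence of `(F₁(t)φ − φ)/t` to `Aφ''` in `L¹(ℝ)`, where
`F₁(t)φ(q) = ∫ (4πtA(q))^{-1/2} exp(−(q−q₁)²/(4tA(q))) φ(q₁) dq₁`:
`‖(F₁(t)φ − φ)/t − Aφ''‖_{L¹} ≤ t A₀^{5/2} a₀^{-1/2} ‖φ''''‖_{L¹}`. -/
theorem statement11 (A : ℝ → ℝ) (hAcont : Continuous A)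
    (a₀ A₀ : ℝ) (ha₀ : 0 < a₀) (ha₀A₀ : a₀ ≤ A₀)
    (hbound : ∀ q : ℝ, a₀ ≤ A q ∧ A q ≤ A₀)
    (φ : ℝ → ℂ) (hφsmooth : ContDiff ℝ (⊤ : ℕ∞) φ) (hφsupp : HasCompactSupport φ)
    (t : ℝ) (ht : 0 < t) :
    ∫ q : ℝ, ‖((∫ q₁ : ℝ, (((4 * Real.pi * t * A q) ^ (-(1 : ℝ) / 2) *
            Real.exp (-(q - q₁) ^ 2 / (4 * t * A q)) : ℝ) : ℂ) * φ q₁) - φ q) / (t : ℂ)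
        - ((A q : ℝ) : ℂ) * iteratedDeriv 2 φ q‖
      ≤ t * (A₀ ^ ((5 : ℝ) / 2) * a₀ ^ (-(1 : ℝ) / 2)) * ∫ q : ℝ, ‖iteratedDeriv 4 φ q‖ := by
  have hA₀ : 0 < A₀ := ha₀.trans_le ha₀A₀
  have hφ4 : ContDiff ℝ 4 φ := contDiff_infty.mp hφsmooth 4
  have key := integral_norm_heatKernel_sub_le hφ4 hφsupp (s := fun q ↦ t * A q)
    (mul_pos ht ha₀) (R := t * A₀)
    (fun q ↦ ⟨mul_le_mul_of_nonneg_left (hbound q).1 ht.le,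
      mul_le_mul_of_nonneg_left (hbound q).2 ht.le⟩)
  have hkernel (q : ℝ) : ∫ q₁ : ℝ, (((4 * Real.pi * t * A q) ^ (-(1 : ℝ) / 2) *
        Real.exp (-(q - q₁) ^ 2 / (4 * t * A q)) : ℝ) : ℂ) * φ q₁ =
      ∫ y, heatKernel (t * A q) y • φ (q + y) := by
    rw [← integral_add_left_eq_self _ q]
    congr 1 with y
    rw [Complex.real_smul, heatKernel]
    simp only [mul_assoc, sub_add_cancel_left, neg_sq]
  have hfun (q : ℝ) : ‖((∫ q₁ : ℝ, (((4 * Real.pi * t * A q) ^ (-(1 : ℝ) / 2) *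
        Real.exp (-(q - q₁) ^ 2 / (4 * t * A q)) : ℝ) : ℂ) * φ q₁) - φ q) / (t : ℂ)
        - ((A q : ℝ) : ℂ) * iteratedDeriv 2 φ q‖ =
      t⁻¹ * ‖(∫ y, heatKernel (t * A q) y • φ (q + y)) - φ q
        - (t * A q) • iteratedDeriv 2 φ q‖ := by
    rw [hkernel, ← norm_smul_of_nonneg (inv_nonneg.mpr ht.le)]
    congr 1
    have : (t : ℂ) ≠ 0 := mod_cast ht.ne'
    simp only [Complex.real_smul]
    push_cast
    field_simp
  have hconst : t⁻¹ * ((t * A₀) ^ ((1 : ℝ) / 2) * (t * a₀) ^ (-(1 : ℝ) / 2) *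
      ((t * A₀) ^ 2 / 2)) = t * (A₀ ^ ((5 : ℝ) / 2) * a₀ ^ (-(1 : ℝ) / 2)) / 2 := by
    have htt : t ^ ((1 : ℝ) / 2) * t ^ (-(1 : ℝ) / 2) = 1 := by
      rw [← Real.rpow_add ht]; norm_num
    have hA : A₀ ^ ((5 : ℝ) / 2) = A₀ ^ ((1 : ℝ) / 2) * A₀ ^ 2 := by
      rw [← Real.rpow_add_natCast hA₀.ne']; norm_num
    rw [Real.mul_rpow ht.le hA₀.le, Real.mul_rpow ht.le ha₀.le, hA]
    calc _ = t⁻¹ * t * t * (t ^ ((1 : ℝ) / 2) * t ^ (-(1 : ℝ) / 2)) *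
          (A₀ ^ ((1 : ℝ) / 2) * A₀ ^ 2 * a₀ ^ (-(1 : ℝ) / 2)) / 2 := by ring
      _ = _ := by rw [htt, inv_mul_cancel₀ ht.ne']; ring
  simp_rw [hfun]
  rw [integral_const_mul]
  refine (mul_le_mul_of_nonneg_left key (inv_nonneg.mpr ht.le)).trans ?_
  rw [← mul_assoc, hconst]
  gcongr
  exact half_le_self (by positivity)
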